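/- (Proposition 3.20) There exist absolute constants A ≥ 1 and c > 0 such that the following holds. Let M ≥ 1, Σ > 0 and B ≥ 5; set N = A(1+Σ)M and H = A(1+Σ)²M²B, and let 0 < ε < c·N⁻¹⁰. Let f : 𝕎 → ℍ be M-bilipschitz, write f = (f₁, f₂, f₃), and let 𝒯 ⊂ 𝒟 be a tree all of whose rectangles are (ε, H, Σ)-vertical for f. Let Q₁, Q₂ ∈ 𝒯 and let wⱼ = (yⱼ, tⱼ) ∈ (H/2)Qⱼ for j = 1,2 be points with y₁ < y₂ and |y₁ − y₂| > max{ min{ℓ(Q₁), ℓ(Q₂)}/100, 4N²·|t₁ − t₂|^{1/2} }. Then |y₂ − y₁|/(2N) ≤ |f₂(w₂) − f₂(w₁)| ≤ M·|y₂ − y₁|. -/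

import Mathlib

open scoped ENNReal

namespace HeisRug

/-- The first Heisenberg group, as a set: ℝ³. -/
abbrev Hei : Type := ℝ × ℝ × ℝ

/-- Heisenberg group multiplication. -/
noncomputable def Hmul (p q : Hei) : Hei :=
  (p.1 + q.1, p.2.1 + q.2.1, p.2.2 + q.2.2 + (p.1 * q.2.1 - q.1 * p.2.1) / 2)

/-- Heisenberg group inverse. -/
def Hinv (p : Hei) : Hei := (-p.1, -p.2.1, -p.2.2)

/-- Homogeneous norm on the Heisenberg group. -/
noncomputable def Hnorm (p : Hei) : ℝ :=
  max (Real.sqrt (p.1 ^ 2 + p.2.1 ^ 2)) (Real.sqrt |p.2.2|)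

/-- Left-invariant metric `d(p,q) = ‖q⁻¹·p‖` on the Heisenberg group. -/
noncomputable def dH (p q : Hei) : ℝ := Hnorm (Hmul (Hinv q) p)

/-- Parabolic metric on the parabolic plane 𝕎 = ℝ². -/
noncomputable def dPar (w w' : ℝ × ℝ) : ℝ :=
  max |w.1 - w'.1| (Real.sqrt |w.2 - w'.2|)

/-- Distance from a point to a set in (ℍ, d). -/
noncomputable def distH (p : Hei) (E : Set Hei) : ℝ := sInf ((dH p) '' E)

/-- Closed δ-neighbourhood of a set in ℍ. -/
def NH (E : Set Hei) (δ : ℝ) : Set Hei := {p | distH p E ≤ δ}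

/-- Closed ball in (ℍ, d). -/
def BH (p : Hei) (r : ℝ) : Set Hei := {q | dH q p ≤ r}

/-- Closed parabolic ball in 𝕎. -/
def BPar (w : ℝ × ℝ) (r : ℝ) : Set (ℝ × ℝ) := {v | dPar v w ≤ r}

/-- Diameter (in ℝ≥0∞) with respect to the Heisenberg metric. -/
noncomputable def ediamH (E : Set Hei) : ℝ≥0∞ :=
  ⨆ p ∈ E, ⨆ q ∈ E, ENNReal.ofReal (dH p q)

/-- The 3-dimensional Hausdorff measure on (ℍ, d), as a set function. -/
noncomputable def H3 (E : Set Hei) : ℝ≥0∞ :=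
  ⨆ (δ : ℝ≥0∞) (_ : 0 < δ),
    ⨅ (U : ℕ → Set Hei) (_ : E ⊆ ⋃ n, U n) (_ : ∀ n, ediamH (U n) ≤ δ),
      ∑' n, ediamH (U n) ^ 3

/-- Isometric embedding of the parabolic plane onto the subgroup 𝕎 ⊂ ℍ. -/
def embedW (w : ℝ × ℝ) : Hei := (0, w.1, w.2)

/-- The vertical subgroup 𝕎 = {(0,y,t)} of ℍ. -/
def Wsub : Set Hei := {p | p.1 = 0}

/-- Rotation by angle θ about the t-axis. -/
noncomputable def Rrot (θ : ℝ) (p : Hei) : Hei :=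
  (p.1 * Real.cos θ - p.2.1 * Real.sin θ, p.1 * Real.sin θ + p.2.1 * Real.cos θ, p.2.2)

/-- Vertical projection Π : ℍ → 𝕎. -/
noncomputable def Piproj (p : Hei) : Hei := (0, p.2.1, p.2.2 + p.1 * p.2.1 / 2)

/-- Horizontal projection Π_𝕃 : ℍ → 𝕃. -/
def PiL (p : Hei) : Hei := (p.1, 0, 0)

/-- Vertical projection Π_θ = R_θ ∘ Π ∘ R_θ⁻¹ onto 𝕎_θ. -/
noncomputable def PiTheta (θ : ℝ) (p : Hei) : Hei := Rrot θ (Piproj (Rrot (-θ) p))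

/-- `f : 𝕎 → ℍ` is M-bilipschitz. -/
def IsBilipschitz (M : ℝ) (f : ℝ × ℝ → Hei) : Prop :=
  ∀ w w' : ℝ × ℝ,
    M⁻¹ * dPar w w' ≤ dH (f w) (f w') ∧ dH (f w) (f w') ≤ M * dPar w w'

/-- A Rickman rug: the image of the parabolic plane under a bilipschitz map. -/
def IsRickmanRug (E : Set Hei) : Prop :=
  ∃ M : ℝ, 1 ≤ M ∧ ∃ f : ℝ × ℝ → Hei, IsBilipschitz M f ∧ E = Set.range f

/-- A horizontal line in ℍ. -/
def IsHorizontalLine (L : Set Hei) : Prop :=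
  ∃ p : Hei, ∃ v : ℝ × ℝ, v ≠ 0 ∧
    L = {q | ∃ s : ℝ, q = Hmul p (s * v.1, s * v.2, 0)}

/-- The vertical plane spanned by a horizontal line. -/
def VSpan (L : Set Hei) : Set Hei := {q | ∃ p ∈ L, ∃ t : ℝ, q = Hmul p (0, 0, t)}

/-- Vertical planes in ℍ. -/
def IsVerticalPlane (V : Set Hei) : Prop :=
  ∃ L : Set Hei, IsHorizontalLine L ∧ V = VSpan L

/-- The horizontal line {(a·y + b, y, b·y/2 + c) : y ∈ ℝ} (of slope |a|). -/
def hline (a b c : ℝ) : Set Hei :=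
  {p | ∃ y : ℝ, p = (a * y + b, y, b * y / 2 + c)}

/-- A horizontal line of (finite) slope at most Σ. -/
def HLineSlopeLe (S : ℝ) (L : Set Hei) : Prop :=
  ∃ a b c : ℝ, |a| ≤ S ∧ L = hline a b c

/-- A vertical plane of (finite) slope at most Σ (relative to 𝕎). -/
def VPlaneSlopeLe (S : ℝ) (V : Set Hei) : Prop :=
  ∃ a b : ℝ, |a| ≤ S ∧ V = {p : Hei | p.1 = a * p.2.1 + b}

/-- A vertical plane whose slope relative to 𝕎_θ equals 0. -/
def SlopeZeroRel (θ : ℝ) (V : Set Hei) : Prop :=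
  ∃ b : ℝ, Rrot (-θ) '' V = {p : Hei | p.1 = b}

/-- The horizontal line ℝ × {t} in the parabolic plane. -/
def lineW (t : ℝ) : Set (ℝ × ℝ) := {w | w.2 = t}

/-- Ruler coefficient ρ_f(B_par(w,r)). -/
noncomputable def rulerCoef (f : ℝ × ℝ → Hei) (w : ℝ × ℝ) (r : ℝ) : ℝ :=
  sInf {ρ : ℝ | 0 < ρ ∧ ∀ t : ℝ, ∃ L : Set Hei, IsHorizontalLine L ∧
    f '' (lineW t ∩ BPar w r) ⊆ NH L (ρ * r)}

/-- β_f(𝕍; B_par(w,r)): approximation number relative to the vertical plane 𝕍. -/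
noncomputable def betaV (f : ℝ × ℝ → Hei) (V : Set Hei) (w : ℝ × ℝ) (r : ℝ) : ℝ :=
  sInf {ε : ℝ | 0 < ε ∧ ∀ t : ℝ, ∃ L : Set Hei, IsHorizontalLine L ∧ L ⊆ V ∧
    f '' (lineW t ∩ BPar w r) ⊆ NH L (ε * r)}

/-- The strong vertical β-number β_f(B_par(w,r)) = inf_𝕍 β_f(𝕍; B_par(w,r)). -/
noncomputable def beta (f : ℝ × ℝ → Hei) (w : ℝ × ℝ) (r : ℝ) : ℝ :=
  sInf {b : ℝ | ∃ V : Set Hei, IsVerticalPlane V ∧ b = betaV f V w r}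

/-- Index set for dyadic parabolic rectangles: (n, k, l). -/
abbrev Idx : Type := ℤ × ℤ × ℤ

/-- Side length ℓ(Q) = 2⁻ⁿ of the dyadic parabolic rectangle with index (n,k,l). -/
noncomputable def sideLen (i : Idx) : ℝ := (2 : ℝ) ^ (-i.1)

/-- The dyadic parabolic rectangle [k·2⁻ⁿ, (k+1)·2⁻ⁿ) × [l·4⁻ⁿ, (l+1)·4⁻ⁿ). -/
noncomputable def rect (i : Idx) : Set (ℝ × ℝ) :=
  Set.Ico ((i.2.1 : ℝ) * (2 : ℝ) ^ (-i.1)) (((i.2.1 : ℝ) + 1) * (2 : ℝ) ^ (-i.1)) ×ˢ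
  Set.Ico ((i.2.2 : ℝ) * (4 : ℝ) ^ (-i.1)) (((i.2.2 : ℝ) + 1) * (4 : ℝ) ^ (-i.1))

/-- The centre c_Q of a dyadic parabolic rectangle. -/
noncomputable def center (i : Idx) : ℝ × ℝ :=
  (((i.2.1 : ℝ) + 1 / 2) * (2 : ℝ) ^ (-i.1), ((i.2.2 : ℝ) + 1 / 2) * (4 : ℝ) ^ (-i.1))

/-- λQ := B_par(c_Q, λ·ℓ(Q)). -/
noncomputable def dilate (lam : ℝ) (i : Idx) : Set (ℝ × ℝ) := BPar (center i) (lam * sideLen i)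

/-- j indexes a 𝒟-child of the rectangle indexed by i. -/
def IsChild (j i : Idx) : Prop := j.1 = i.1 + 1 ∧ rect j ⊆ rect i

/-- T ⊆ 𝒟 is a tree with root rt. -/
def IsTreeWithRoot (T : Set Idx) (rt : Idx) : Prop :=
  rt ∈ T ∧ (∀ i ∈ T, rect i ⊆ rect rt) ∧
  (∀ i j k : Idx, i ∈ T → k ∈ T → rect i ⊆ rect j → rect j ⊆ rect k → j ∈ T) ∧
  (∀ i ∈ T, (∀ j : Idx, IsChild j i → j ∈ T) ∨ (∀ j : Idx, IsChild j i → j ∉ T))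

/-- T ⊆ 𝒟 is a tree. -/
def IsTree (T : Set Idx) : Prop := ∃ rt : Idx, IsTreeWithRoot T rt

/-- Q is (ε,H,Σ)-vertical for f : there is a vertical plane 𝕍_Q of slope ≤ Σ with
β_f(𝕍_Q; HQ) < ε/H. -/
def IsVerticalRect (f : ℝ × ℝ → Hei) (ε Hc S : ℝ) (i : Idx) : Prop :=
  ∃ V : Set Hei, VPlaneSlopeLe S V ∧ betaV f V (center i) (Hc * sideLen i) < ε / Hc

/-- Q is (δ,C)-ruled for f. -/
def IsRuled (f : ℝ × ℝ → Hei) (δ C : ℝ) (i : Idx) : Prop :=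
  ∀ t : ℝ, ∃ L : Set Hei, IsHorizontalLine L ∧
    f '' (lineW t ∩ dilate C i) ⊆ NH L (δ * sideLen i)

/-- Q is (δ,C,Σ)-ruled for f. -/
def IsRuledSlope (f : ℝ × ℝ → Hei) (δ C S : ℝ) (i : Idx) : Prop :=
  IsRuled f δ C i ∧ ∃ t : ℝ, (lineW t ∩ rect i).Nonempty ∧
    ∃ L : Set Hei, HLineSlopeLe S L ∧
      f '' (lineW t ∩ dilate C i) ⊆ NH L (δ * sideLen i)

/-- Γ is an intrinsic L-Lipschitz graph over 𝕎. -/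
def IsIntrinsicLipGraph (L : ℝ) (Γ : Set Hei) : Prop :=
  Set.BijOn Piproj Γ Wsub ∧
  ∀ p ∈ Γ, ∀ q ∈ Γ,
    Hnorm (PiL (Hmul (Hinv q) p)) ≤ L * Hnorm (Piproj (Hmul (Hinv q) p))

/-- Γ is an intrinsic L-Lipschitz graph over 𝕎_θ. -/
def IsIntrinsicLipGraphOver (θ L : ℝ) (Γ : Set Hei) : Prop :=
  IsIntrinsicLipGraph L (Rrot (-θ) '' Γ)

/-- An intrinsic bilipschitz graph: an intrinsic Lipschitz graph over some vertical
subgroup which is also a Rickman rug. -/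
def IsIntrinsicBilipGraph (Γ : Set Hei) : Prop :=
  (∃ θ ∈ Set.Ico (-(Real.pi / 2)) (Real.pi / 2), ∃ L : ℝ, 1 ≤ L ∧
    IsIntrinsicLipGraphOver θ L Γ) ∧ IsRickmanRug Γ

/-- (M,ε)-quasi-isometric embedding between sets with distance functions. -/
def IsQIEOn {X Y : Type*} (dX : X → X → ℝ) (dY : Y → Y → ℝ) (A : Set X)
    (M ε : ℝ) (F : X → Y) : Prop :=
  ∀ x ∈ A, ∀ x' ∈ A,
    M⁻¹ * dX x x' - ε ≤ dY (F x) (F x') ∧ dY (F x) (F x') ≤ M * dX x x' + ε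

/-- d is a metric on ℝ. -/
def IsMetricOn (d : ℝ → ℝ → ℝ) : Prop :=
  (∀ x y, d x y = d y x) ∧ (∀ x y, d x y = 0 ↔ x = y) ∧
  (∀ x y z, d x z ≤ d x y + d y z)

/-- d is an orderly metric on ℝ. -/
def Orderly (d : ℝ → ℝ → ℝ) : Prop :=
  IsMetricOn d ∧
  (∀ x : ℝ, ∀ ε > (0 : ℝ), ∃ δ > (0 : ℝ), ∀ y : ℝ, |x - y| < δ → d x y < ε) ∧
  (∀ x y z : ℝ, x ≤ y → y ≤ z → max (d x y) (d y z) ≤ d x z)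

/-- F : I×J → 𝕎 is a horizontal (M,ε)-QIE. -/
def IsHorizQIE (M ε : ℝ) (I J : Set ℝ) (F : ℝ × ℝ → ℝ × ℝ) : Prop :=
  IsQIEOn dPar dPar (I ×ˢ J) M ε F ∧
  (∀ t ∈ J, ∃ c : ℝ, ∀ y ∈ I, (F (y, t)).2 = c)


theorem Hnorm_le_iff {p : Hei} {n : ℝ} (hn : 0 ≤ n) :
    Hnorm p ≤ n ↔ p.1 ^ 2 + p.2.1 ^ 2 ≤ n ^ 2 ∧ |p.2.2| ≤ n ^ 2 := by
  unfold Hnorm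
  rw [max_le_iff, Real.sqrt_le_left hn, Real.sqrt_le_left hn]

theorem Hnorm_nonneg (p : Hei) : 0 ≤ Hnorm p :=
  le_max_of_le_left (Real.sqrt_nonneg _)

theorem Hnorm_mul_le (p q : Hei) : Hnorm (Hmul p q) ≤ Hnorm p + Hnorm q := by
  have h1 := Hnorm_nonneg p
  have h2 := Hnorm_nonneg q
  obtain ⟨a1, a2⟩ := (Hnorm_le_iff h1).1 le_rfl
  obtain ⟨b1, b2⟩ := (Hnorm_le_iff h2).1 le_rfl
  rw [Hnorm_le_iff (by positivity)]
  generalize Hnorm p = m at *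
  generalize Hnorm q = n at *
  obtain ⟨x, y, t⟩ := p
  obtain ⟨u, v, s⟩ := q
  simp only [Hmul] at *
  have hprod : (x ^ 2 + y ^ 2) * (u ^ 2 + v ^ 2) ≤ (m * n) ^ 2 := by
    rw [mul_pow]; gcongr
  have c1 : |x * u + y * v| ≤ m * n := by
    apply abs_le_of_sq_le_sq _ (by positivity)
    nlinarith [sq_nonneg (x * v - y * u)]
  have c2 : |x * v - u * y| ≤ m * n := by
    apply abs_le_of_sq_le_sq _ (by positivity)
    nlinarith [sq_nonneg (x * u + y * v)]
  rw [abs_le] at *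
  have : 0 ≤ m * n := by positivity
  refine ⟨by nlinarith, ?_⟩
  constructor <;> nlinarith

theorem dH_triangle (p q r : Hei) : dH p r ≤ dH p q + dH q r := by
  have : Hmul (Hinv r) p = Hmul (Hmul (Hinv r) q) (Hmul (Hinv q) p) := by
    simp only [Hmul, Hinv]
    ext <;> simp <;> ring
  unfold dH
  rw [this]
  linarith [Hnorm_mul_le (Hmul (Hinv r) q) (Hmul (Hinv q) p)]

theorem dH_comm (p q : Hei) : dH p q = dH q p := by
  simp only [dH, Hnorm, Hmul, Hinv]
  congr 2
  · ring
  · rw [← abs_neg]; congr 1; ring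

theorem abs_y_le_dH (p q : Hei) : |p.2.1 - q.2.1| ≤ dH p q := by
  apply le_max_of_le_left
  apply Real.abs_le_sqrt
  simp only [Hmul, Hinv]
  nlinarith [sq_nonneg (-q.1 + p.1)]

/-- Points on a horizontal line in a vertical plane of slope at most `S`. -/
theorem dH_line_le {S a b : ℝ} (ha : |a| ≤ S) {L : Set Hei} (hL : IsHorizontalLine L)
    (hV : L ⊆ {p : Hei | p.1 = a * p.2.1 + b}) {p q : Hei} (hp : p ∈ L) (hq : q ∈ L) :
    dH p q ≤ (1 + S) * |p.2.1 - q.2.1| := by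
  have hpx : p.1 = a * p.2.1 + b := hV hp
  have hqx : q.1 = a * q.2.1 + b := hV hq
  have hS : 0 ≤ S := (abs_nonneg a).trans ha
  obtain ⟨o, v, hv, rfl⟩ := hL
  obtain ⟨s, rfl⟩ := hp
  obtain ⟨s', rfl⟩ := hq
  unfold dH
  rw [Hnorm_le_iff (by positivity)]
  have haa : a ^ 2 ≤ S ^ 2 := sq_le_sq' (by linarith [neg_abs_le a]) (by linarith [le_abs_self a])
  simp only [Hmul, Hinv] at *
  constructor
  · have e : -(o.1 + s' * v.1) + (o.1 + s * v.1) =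
      a * (o.2.1 + s * v.2 - (o.2.1 + s' * v.2)) := by linarith
    rw [e, mul_pow, mul_pow, sq_abs]
    have e2 : -(o.2.1 + s' * v.2) + (o.2.1 + s * v.2) =
      (o.2.1 + s * v.2 - (o.2.1 + s' * v.2)) := by ring
    rw [e2]
    nlinarith [sq_nonneg (o.2.1 + s * v.2 - (o.2.1 + s' * v.2)),
      mul_le_mul_of_nonneg_right haa (sq_nonneg (o.2.1 + s * v.2 - (o.2.1 + s' * v.2)))]
  · ring_nf
    simp only [abs_zero]
    positivity

/-- Unpacking of verticality. -/
theorem vertical_unpack {f : ℝ × ℝ → Hei} {M ε H S : ℝ} (hM : 1 ≤ M) (hf : IsBilipschitz M f)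
    (hH : 0 < H) {i : Idx} (hi : IsVerticalRect f ε H S i)
    {w w' : ℝ × ℝ} (hw : w ∈ dilate H i) (hw' : w' ∈ dilate H i) (ht : w.2 = w'.2) :
    dH (f w) (f w') ≤ 2 * (ε * sideLen i) +
      (1 + S) * (|(f w).2.1 - (f w').2.1| + 2 * (ε * sideLen i)) := by
  obtain ⟨V, ⟨a, b, ha, rfl⟩, hb⟩ := hi
  have hl : 0 < sideLen i := by unfold sideLen; positivity
  have hS : 0 ≤ S := (abs_nonneg a).trans ha
  have hr : 0 < H * sideLen i := by positivity
  have hlb : ∀ (p : Hei) (E : Set Hei), BddBelow ((dH p) '' E) := by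
    intro p E
    refine ⟨0, ?_⟩
    rintro _ ⟨q, _, rfl⟩
    exact Hnorm_nonneg _
  unfold betaV at hb
  have hne : {ε : ℝ | 0 < ε ∧ ∀ t : ℝ, ∃ L : Set Hei, IsHorizontalLine L ∧
      L ⊆ {p : Hei | p.1 = a * p.2.1 + b} ∧
      f '' (lineW t ∩ BPar (center i) (H * sideLen i)) ⊆ NH L (ε * (H * sideLen i))}.Nonempty := by
    set r := H * sideLen i
    set p0 : Hei := (b, 0, 0)
    have hD : 0 ≤ dH (f (center i)) p0 := Hnorm_nonneg _
    refine ⟨M + dH (f (center i)) p0 / r + 1, by positivity, fun t => ?_⟩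
    refine ⟨{q | ∃ s : ℝ, q = Hmul p0 (s * (a, (1:ℝ)).1, s * (a, (1:ℝ)).2, 0)},
      ⟨p0, (a, 1), by simp, rfl⟩, ?_, ?_⟩
    · rintro _ ⟨s, rfl⟩
      simp [Hmul, p0]
      ring
    · rintro _ ⟨v, ⟨_, hv⟩, rfl⟩
      have hv' : dPar v (center i) ≤ r := hv
      have h1 := (hf v (center i)).2
      have h2 := dH_triangle (f v) (f (center i)) p0
      have h3 : distH (f v) {q | ∃ s : ℝ, q = Hmul p0 (s * (a, (1:ℝ)).1, s * (a, (1:ℝ)).2, 0)}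
          ≤ dH (f v) p0 := by
        apply csInf_le (hlb _ _)
        refine ⟨p0, ⟨0, ?_⟩, rfl⟩
        simp [Hmul, p0]
      have h4 : M * dPar v (center i) ≤ M * r := by gcongr
      have h5 : (M + dH (f (center i)) p0 / r + 1) * r = M * r + dH (f (center i)) p0 + r := by
        field_simp
      change distH _ _ ≤ _
      rw [h5]
      linarith
  obtain ⟨e, ⟨he0, he⟩, hlt⟩ := exists_lt_of_csInf_lt hne hb
  obtain ⟨L, hL, hLV, hsub⟩ := he w.2
  have hlt' : e * (H * sideLen i) < ε * sideLen i := by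
    have : e * H < ε := (lt_div_iff₀ hH).1 hlt
    nlinarith
  have key : ∀ u : ℝ × ℝ, u.2 = w.2 → u ∈ dilate H i → ∃ p ∈ L, dH (f u) p < ε * sideLen i := by
    intro u hu hud
    have h1 : distH (f u) L ≤ e * (H * sideLen i) := hsub ⟨u, ⟨hu, hud⟩, rfl⟩
    have hLne : ((dH (f u)) '' L).Nonempty := by
      obtain ⟨o, v, _, rfl⟩ := hL
      exact Set.Nonempty.image _ ⟨_, 0, rfl⟩
    obtain ⟨_, ⟨p, hp, rfl⟩, hpl⟩ := exists_lt_of_csInf_lt hLne (lt_of_le_of_lt h1 hlt')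
    exact ⟨p, hp, hpl⟩
  obtain ⟨p, hp, hpd⟩ := key w rfl hw
  obtain ⟨q, hq, hqd⟩ := key w' ht.symm hw'
  have h1 := dH_line_le ha hL hLV hp hq
  have h2 := dH_triangle (f w) p (f w')
  have h3 := dH_triangle p q (f w')
  rw [dH_comm q] at h3
  have h4 := abs_y_le_dH (f w) p
  have h5 := abs_y_le_dH (f w') q
  have h6 : |p.2.1 - q.2.1| ≤ |(f w).2.1 - (f w').2.1| + 2 * (ε * sideLen i) := by
    rw [abs_le] at *
    have := neg_abs_le ((f w).2.1 - (f w').2.1)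
    have := le_abs_self ((f w).2.1 - (f w').2.1)
    constructor <;> linarith
  have h7 : (1 + S) * |p.2.1 - q.2.1| ≤
      (1 + S) * (|(f w).2.1 - (f w').2.1| + 2 * (ε * sideLen i)) := by gcongr
  linarith

/-- Main estimate, given a good rectangle. -/
theorem core_estimate {f : ℝ × ℝ → Hei} {M ε H S Y : ℝ} (hM : 1 ≤ M) (hS : 0 < S)
    (hf : IsBilipschitz M f) (hH : 0 < H) (hε : 0 < ε)
    (hεc : ε < (1 / 400) / (4 * (1 + S) * M) ^ 10)
    {i : Idx} (hi : IsVerticalRect f ε H S i)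
    {w w' : ℝ × ℝ} (hw : w ∈ dilate H i) (hw' : (w'.1, w.2) ∈ dilate H i)
    (hY : Y = |w.1 - w'.1|) (hl : sideLen i < 100 * Y)
    (ht : 4 * (4 * (1 + S) * M) ^ 2 * Real.sqrt |w.2 - w'.2| < Y) :
    Y / (2 * (4 * (1 + S) * M)) ≤ |(f w).2.1 - (f w').2.1| := by
  have hl0 : 0 < sideLen i := by unfold sideLen; positivity
  have hY0 : 0 < Y := by linarith
  have h1 := vertical_unpack hM hf hH hi hw hw' rfl
  have h2 := (hf w (w'.1, w.2)).1
  have h3 := (hf (w'.1, w.2) w').2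
  have h4 := abs_y_le_dH (f (w'.1, w.2)) (f w')
  have h5 : dPar w (w'.1, w.2) = Y := by simp [dPar, hY]
  have h6 : dPar (w'.1, w.2) w' = Real.sqrt |w.2 - w'.2| := by simp [dPar]
  rw [h5] at h2
  rw [h6] at h3
  set K := (1 + S) * M with hK
  have hKM : M ≤ K := by nlinarith
  have hK1 : 1 ≤ K := by linarith
  have e4 : 4 * (1 + S) * M = 4 * K := by rw [hK]; ring
  rw [e4] at hεc ht ⊢
  have hεK : ε * K ≤ 1 / 1600 := by
    have hp : (4 * K) ^ 1 ≤ (4 * K) ^ 10 := pow_le_pow_right₀ (by linarith) (by norm_num)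
    have hpp : 0 < (4 * K) ^ 10 := by positivity
    rw [lt_div_iff₀ hpp] at hεc
    have : ε * (4 * K) ^ 1 ≤ ε * (4 * K) ^ 10 := by gcongr
    linarith
  set g := Real.sqrt |w.2 - w'.2| with hg
  have hg0 : 0 ≤ g := Real.sqrt_nonneg _
  set F := |(f w).2.1 - (f w').2.1| with hF
  set G := |(f w).2.1 - (f (w'.1, w.2)).2.1| with hG
  have hFG : G ≤ F + M * g := by
    have := abs_sub_le (f w).2.1 (f w').2.1 (f (w'.1, w.2)).2.1
    rw [abs_sub_comm (f w').2.1] at this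
    linarith
  -- multiply by M
  have h7 : Y ≤ M * (2 * (ε * sideLen i) + (1 + S) * (G + 2 * (ε * sideLen i))) := by
    have := h2.trans h1
    rwa [inv_mul_le_iff₀ (by linarith)] at this
  have h8 : ε * sideLen i ≤ ε * (100 * Y) := by gcongr
  have h9 : Y ≤ 2 * M * (ε * (100 * Y)) + K * (G + 2 * (ε * (100 * Y))) := by
    calc Y ≤ _ := h7
      _ ≤ M * (2 * (ε * (100 * Y)) + (1 + S) * (G + 2 * (ε * (100 * Y)))) := by gcongr
      _ = _ := by rw [hK]; ring
  have h10 : M * (ε * (100 * Y)) ≤ K * (ε * (100 * Y)) := by gcongr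
  have h11 : (ε * K) * Y ≤ 1 / 1600 * Y := by gcongr
  have h12 : K * G ≤ K * (F + M * g) := by gcongr
  have h13 : K * (M * g) ≤ K * (K * g) := by gcongr
  rw [div_le_iff₀ (by positivity)]
  nlinarith

theorem rect_subset_iff (i r : Idx) : rect i ⊆ rect r ↔
    ((r.2.1 : ℝ) * (2 : ℝ) ^ (-r.1) ≤ (i.2.1 : ℝ) * (2 : ℝ) ^ (-i.1) ∧
      ((i.2.1 : ℝ) + 1) * (2 : ℝ) ^ (-i.1) ≤ ((r.2.1 : ℝ) + 1) * (2 : ℝ) ^ (-r.1)) ∧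
    ((r.2.2 : ℝ) * (4 : ℝ) ^ (-r.1) ≤ (i.2.2 : ℝ) * (4 : ℝ) ^ (-i.1) ∧
      ((i.2.2 : ℝ) + 1) * (4 : ℝ) ^ (-i.1) ≤ ((r.2.2 : ℝ) + 1) * (4 : ℝ) ^ (-r.1)) := by
  have h2 : (0:ℝ) < (2 : ℝ) ^ (-i.1) := by positivity
  have h4 : (0:ℝ) < (4 : ℝ) ^ (-i.1) := by positivity
  have n2 : (i.2.1 : ℝ) * (2 : ℝ) ^ (-i.1) < ((i.2.1 : ℝ) + 1) * (2 : ℝ) ^ (-i.1) := by linarith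
  have n4 : (i.2.2 : ℝ) * (4 : ℝ) ^ (-i.1) < ((i.2.2 : ℝ) + 1) * (4 : ℝ) ^ (-i.1) := by linarith
  unfold rect
  rw [Set.prod_subset_prod_iff, Set.Ico_subset_Ico_iff n2, Set.Ico_subset_Ico_iff n4]
  simp only [Set.Ico_eq_empty_iff, not_lt, not_le.2 n2, not_le.2 n4, or_false]

theorem level_le {i r : Idx} (h : rect i ⊆ rect r) : r.1 ≤ i.1 := by
  rw [rect_subset_iff] at h
  have : (2:ℝ) ^ (-i.1) ≤ (2:ℝ) ^ (-r.1) := by linarith [h.1.1, h.1.2]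
  rw [zpow_le_zpow_iff_right₀ (by norm_num)] at this
  linarith

/-- The dyadic parent. -/
def par (i : Idx) : Idx := (i.1 - 1, i.2.1 / 2, i.2.2 / 4)

/-- One-dimensional comparison: integer form. -/
theorem int_form {b : ℕ} (hb : 0 < b) {x y m n : ℤ} {d : ℕ} (hd : n = m + d) :
    ((x : ℝ) * (b : ℝ) ^ (-m) ≤ (y : ℝ) * (b : ℝ) ^ (-n) ↔ x * (b : ℤ) ^ d ≤ y) := by
  have hb' : (0:ℝ) < b := by exact_mod_cast hb
  have e : (b : ℝ) ^ (-m) = (b : ℝ) ^ d * (b : ℝ) ^ (-n) := by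
    rw [← zpow_natCast, ← zpow_add₀ hb'.ne']
    congr 1
    omega
  rw [e, ← mul_assoc, mul_le_mul_iff_left₀ (by positivity)]
  exact_mod_cast Iff.rfl

theorem int_form' {b : ℕ} (hb : 0 < b) {x y m n : ℤ} {d : ℕ} (hd : n = m + d) :
    ((y : ℝ) * (b : ℝ) ^ (-n) ≤ (x : ℝ) * (b : ℝ) ^ (-m) ↔ y ≤ x * (b : ℤ) ^ d) := by
  have hb' : (0:ℝ) < b := by exact_mod_cast hb
  have e : (b : ℝ) ^ (-m) = (b : ℝ) ^ d * (b : ℝ) ^ (-n) := by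
    rw [← zpow_natCast, ← zpow_add₀ hb'.ne']
    congr 1
    omega
  rw [e, ← mul_assoc, mul_le_mul_iff_left₀ (by positivity)]
  exact_mod_cast Iff.rfl

theorem rect_subset_iff_int {i r : Idx} {d : ℕ} (hd : i.1 = r.1 + d) : rect i ⊆ rect r ↔
    (r.2.1 * 2 ^ d ≤ i.2.1 ∧ i.2.1 + 1 ≤ (r.2.1 + 1) * 2 ^ d) ∧
    (r.2.2 * 4 ^ d ≤ i.2.2 ∧ i.2.2 + 1 ≤ (r.2.2 + 1) * 4 ^ d) := by
  rw [rect_subset_iff]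
  have h1 := int_form (b := 2) (by norm_num) (x := r.2.1) (y := i.2.1) hd
  have h2 := int_form' (b := 2) (by norm_num) (x := r.2.1 + 1) (y := i.2.1 + 1) hd
  have h3 := int_form (b := 4) (by norm_num) (x := r.2.2) (y := i.2.2) hd
  have h4 := int_form' (b := 4) (by norm_num) (x := r.2.2 + 1) (y := i.2.2 + 1) hd
  push_cast at h1 h2 h3 h4
  rw [h1, h2, h3, h4]

theorem subset_par (i : Idx) : rect i ⊆ rect (par i) := by
  rw [rect_subset_iff_int (d := 1) (by simp [par])]
  simp only [par]
  omega

theorem par_subset {i r : Idx} (h : rect i ⊆ rect r) (hlt : r.1 < i.1) :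
    rect (par i) ⊆ rect r := by
  obtain ⟨d, hd⟩ : ∃ d : ℕ, i.1 = r.1 + (d + 1 : ℕ) :=
    ⟨(i.1 - r.1 - 1).toNat, by omega⟩
  rw [rect_subset_iff_int hd] at h
  rw [rect_subset_iff_int (d := d) (by simp only [par]; push_cast at hd; omega)]
  simp only [par, pow_succ, ← mul_assoc] at *
  generalize r.2.1 * 2 ^ d = a at *
  generalize (r.2.1 + 1) * 2 ^ d = a' at *
  generalize r.2.2 * 4 ^ d = b at *
  generalize (r.2.2 + 1) * 4 ^ d = b' at *
  omega

theorem eq_of_level {i r : Idx} (h : rect i ⊆ rect r) (hl : i.1 = r.1) : i = r := by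
  rw [rect_subset_iff_int (d := 0) (by simpa using hl)] at h
  simp only [pow_zero, mul_one] at h
  ext
  · exact hl
  · omega
  · omega

theorem sideLen_pos (i : Idx) : 0 < sideLen i := by unfold sideLen; positivity

theorem sideLen_par (i : Idx) : sideLen (par i) = 2 * sideLen i := by
  simp only [sideLen, par]
  rw [show -(i.1 - 1) = -i.1 + 1 by ring, zpow_add₀ (by norm_num)]
  ring

theorem mem_dilate {lam : ℝ} {i : Idx} {w : ℝ × ℝ} (hlam : 0 ≤ lam) : w ∈ dilate lam i ↔
    |w.1 - (center i).1| ≤ lam * sideLen i ∧ |w.2 - (center i).2| ≤ (lam * sideLen i) ^ 2 := by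
  have := sideLen_pos i
  change dPar w (center i) ≤ _ ↔ _
  unfold dPar
  rw [max_le_iff, Real.sqrt_le_left (by positivity)]

theorem center_mem (i : Idx) : |(center i).1 - (center (par i)).1| ≤ sideLen i ∧
    |(center i).2 - (center (par i)).2| ≤ 2 * sideLen i ^ 2 := by
  have h := (rect_subset_iff _ _).1 (subset_par i)
  have e4 : (4:ℝ) ^ (-i.1) = sideLen i ^ 2 := by
    rw [sideLen, ← zpow_natCast, ← zpow_mul, mul_comm, zpow_mul]; norm_num
  have e4' : (4:ℝ) ^ (-(par i).1) = 4 * sideLen i ^ 2 := by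
    rw [← e4]
    simp only [par]
    rw [show -(i.1 - 1) = -i.1 + 1 by ring, zpow_add₀ (by norm_num)]
    ring
  have e2' : (2:ℝ) ^ (-(par i).1) = 2 * sideLen i := sideLen_par i
  have e2 : (2:ℝ) ^ (-i.1) = sideLen i := rfl
  have := sideLen_pos i
  simp only [center]
  rw [e4, e4', e2, e2'] at h
  rw [e4, e4', e2, e2']
  have : 0 < sideLen i ^ 2 := by positivity
  constructor <;> rw [abs_le] <;> constructor <;> linarith [h.1.1, h.1.2, h.2.1, h.2.2]

theorem dilate_par {lam : ℝ} (hlam : 2 ≤ lam) {i : Idx} {w : ℝ × ℝ} (hw : w ∈ dilate lam i) :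
    w ∈ dilate lam (par i) := by
  rw [mem_dilate (by linarith)] at *
  obtain ⟨h1, h2⟩ := center_mem i
  have hp := sideLen_pos i
  rw [sideLen_par]
  have t1 := abs_sub_le w.1 (center i).1 (center (par i)).1
  have t2 := abs_sub_le w.2 (center i).2 (center (par i)).2
  have : 2 * sideLen i ≤ lam * sideLen i := by gcongr
  constructor
  · linarith [hw.1]
  · nlinarith [hw.2]

/-- Climb from a tree rectangle to the right scale. -/
theorem climb {T : Set Idx} {rt : Idx} (hT : IsTreeWithRoot T rt) {lam Y : ℝ} (hlam : 2 ≤ lam)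
    {w : ℝ × ℝ} (k : ℕ) : ∀ i ∈ T, i.1 = rt.1 + k → w ∈ dilate lam i → sideLen i < 100 * Y →
    ∃ j ∈ T, w ∈ dilate lam j ∧ sideLen j < 100 * Y ∧ (Y ≤ lam * sideLen j ∨ j = rt) := by
  induction k with
  | zero =>
    intro i hi hk hw hl
    exact ⟨i, hi, hw, hl, Or.inr (eq_of_level (hT.2.1 i hi) (by simpa using hk))⟩
  | succ k ih =>
    intro i hi hk hw hl
    by_cases hY : Y ≤ lam * sideLen i
    · exact ⟨i, hi, hw, hl, Or.inl hY⟩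
    · have hp := sideLen_pos i
      have hs := par_subset (hT.2.1 i hi) (by push_cast at hk; omega)
      refine ih (par i) (hT.2.2.1 i (par i) rt hi hT.1 (subset_par i) hs) ?_
        (dilate_par hlam hw) ?_
      · simp only [par]; push_cast at hk; omega
      · rw [sideLen_par]; nlinarith

theorem climb_root {T : Set Idx} {rt : Idx} (hT : IsTreeWithRoot T rt) {lam : ℝ} (hlam : 2 ≤ lam)
    {w : ℝ × ℝ} (k : ℕ) : ∀ i ∈ T, i.1 = rt.1 + k → w ∈ dilate lam i → w ∈ dilate lam rt := by
  induction k with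
  | zero =>
    intro i hi hk hw
    rwa [← eq_of_level (hT.2.1 i hi) (by simpa using hk)]
  | succ k ih =>
    intro i hi hk hw
    have hs := par_subset (hT.2.1 i hi) (by push_cast at hk; omega)
    refine ih (par i) (hT.2.2.1 i (par i) rt hi hT.1 (subset_par i) hs) ?_ (dilate_par hlam hw)
    simp only [par]; push_cast at hk; omega

theorem lower_bound {f : ℝ × ℝ → Hei} {M ε H S Y : ℝ} (hM : 1 ≤ M) (hS : 0 < S)
    (hf : IsBilipschitz M f) (hH : 4 ≤ H) (hε : 0 < ε)
    (hεc : ε < (1 / 400) / (4 * (1 + S) * M) ^ 10)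
    {T : Set Idx} (hT : IsTree T) (hv : ∀ i ∈ T, IsVerticalRect f ε H S i)
    {i i' : Idx} (hi : i ∈ T) (hi' : i' ∈ T)
    {w w' : ℝ × ℝ} (hw : w ∈ dilate (H / 2) i) (hw' : w' ∈ dilate (H / 2) i')
    (hY : Y = |w.1 - w'.1|) (hl : sideLen i < 100 * Y)
    (ht : 4 * (4 * (1 + S) * M) ^ 2 * Real.sqrt |w.2 - w'.2| < Y) :
    Y / (2 * (4 * (1 + S) * M)) ≤ |(f w).2.1 - (f w').2.1| := by
  obtain ⟨rt, hT⟩ := hT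
  have l1 := level_le (hT.2.1 i hi)
  have l2 := level_le (hT.2.1 i' hi')
  obtain ⟨j, hj, hwj, hlj, hor⟩ := climb hT (lam := H / 2) (by linarith) (i.1 - rt.1).toNat i hi
    (by omega) hw hl
  have hw'r := climb_root hT (lam := H / 2) (by linarith) (i'.1 - rt.1).toNat i' hi'
    (by omega) hw'
  have hp := sideLen_pos j
  rw [mem_dilate (by linarith)] at hwj hw'r
  have hm : H / 2 * sideLen j ≤ H * sideLen j := by nlinarith
  have hm2 : (H / 2 * sideLen j) ^ 2 ≤ (H * sideLen j) ^ 2 := by gcongr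
  refine core_estimate hM hS hf (by linarith) hε hεc (hv j hj)
    ((mem_dilate (by linarith)).2 ⟨by linarith, by linarith⟩)
    ((mem_dilate (by linarith)).2 ⟨?_, by simpa using hwj.2.trans hm2⟩) hY hlj ht
  simp only
  rcases hor with h | rfl
  · have := abs_sub_le w'.1 w.1 (center j).1
    rw [abs_sub_comm w'.1 w.1, ← hY] at this
    linarith
  · linarith

/-- **Proposition 3.20.** Global bilipschitz property of the second coordinate
f₂ along a vertical tree. -/
theorem tree_second_coordinate_bilipschitz :
    ∃ A : ℝ, 1 ≤ A ∧ ∃ c > (0 : ℝ),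
      ∀ M : ℝ, 1 ≤ M → ∀ S > (0 : ℝ), ∀ B : ℝ, 5 ≤ B →
        ∀ ε : ℝ, 0 < ε → ε < c / (A * (1 + S) * M) ^ 10 →
          ∀ f : ℝ × ℝ → Hei, IsBilipschitz M f →
            ∀ T : Set Idx, IsTree T →
              (∀ i ∈ T, IsVerticalRect f ε (A * (1 + S) ^ 2 * M ^ 2 * B) S i) →
              ∀ i₁ ∈ T, ∀ i₂ ∈ T, ∀ w₁ w₂ : ℝ × ℝ,
                w₁ ∈ dilate (A * (1 + S) ^ 2 * M ^ 2 * B / 2) i₁ →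
                w₂ ∈ dilate (A * (1 + S) ^ 2 * M ^ 2 * B / 2) i₂ →
                w₁.1 < w₂.1 →
                max (min (sideLen i₁) (sideLen i₂) / 100)
                    (4 * (A * (1 + S) * M) ^ 2 * Real.sqrt |w₁.2 - w₂.2|)
                  < |w₁.1 - w₂.1| →
                |w₂.1 - w₁.1| / (2 * (A * (1 + S) * M)) ≤ |(f w₂).2.1 - (f w₁).2.1| ∧
                |(f w₂).2.1 - (f w₁).2.1| ≤ M * |w₂.1 - w₁.1| := by
  refine ⟨4, by norm_num, 1 / 400, by norm_num, ?_⟩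
  intro M hM S hS B hB ε hε hεc f hf T hT hv i₁ h₁ i₂ h₂ w₁ w₂ hw₁ hw₂ hlt hmax
  have hH : (4:ℝ) ≤ 4 * (1 + S) ^ 2 * M ^ 2 * B := by
    have a1 : 1 ≤ (1 + S) ^ 2 := one_le_pow₀ (by linarith)
    have a2 : 1 ≤ M ^ 2 := one_le_pow₀ hM
    have a3 : 1 ≤ (1 + S) ^ 2 * M ^ 2 := one_le_mul_of_one_le_of_one_le a1 a2
    nlinarith
  rw [max_lt_iff] at hmax
  obtain ⟨hm1, hm2⟩ := hmax
  constructor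
  · rcases le_total (sideLen i₁) (sideLen i₂) with h | h
    · rw [min_eq_left h] at hm1
      have := lower_bound hM hS hf hH hε hεc hT hv h₁ h₂ hw₁ hw₂ rfl (by linarith) hm2
      rwa [abs_sub_comm w₂.1, abs_sub_comm (f w₂).2.1]
    · rw [min_eq_right h] at hm1
      rw [abs_sub_comm w₁.1] at hm1 hm2
      rw [abs_sub_comm w₁.2] at hm2
      exact lower_bound hM hS hf hH hε hεc hT hv h₂ h₁ hw₂ hw₁ rfl (by linarith) hm2
  · have h1 := abs_y_le_dH (f w₂) (f w₁)
    have h2 := (hf w₂ w₁).2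
    have h3 : dPar w₂ w₁ = |w₂.1 - w₁.1| := by
      apply max_eq_left
      rw [abs_sub_comm w₂.2, abs_sub_comm w₂.1]
      have hs := Real.sqrt_nonneg |w₁.2 - w₂.2|
      have hn : (1:ℝ) ≤ (4 * (1 + S) * M) ^ 2 := one_le_pow₀ (by nlinarith)
      nlinarith
    rw [h3] at h2
    linarith

end HeisRug
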